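/- (Besov–variation embedding.) Let E be a Banach space, q ∈ [1, ∞), β ∈ (1/q, 1), and let X : [0,1] → E be continuous with Besov seminorm M := (∫_0^1 ∫_0^1 ‖X(t) − X(s)‖^q |t − s|^{−1−βq} ds dt)^{1/q} < ∞. Then there is a constant C depending only on β and q such that ‖X‖_{(1/β)-var} ≤ C M, where ‖X‖_{(1/β)-var} := (sup over finite partitions 0 = t_0 < … < t_k = 1 of Σ_i ‖X(t_i) − X(t_{i−1})‖^{1/β})^{β}. -/

import Mathlib

open MeasureTheory Set
open scoped ENNReal

/-- A partition `0 = t_0 ≤ t_1 ≤ … ≤ t_k = 1` of `[0,1]`. -/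
def IsPartition {k : ℕ} (t : Fin (k + 1) → ℝ) : Prop :=
  Monotone t ∧ t 0 = 0 ∧ t (Fin.last k) = 1

/-- The `r`-variation (valued in `[0,∞]`) of a path `X : [0,1] → E`:
`‖X‖_{r-var} = (sup_P ∑_i ‖X(t_i) − X(t_{i−1})‖^r)^{1/r}`. -/
noncomputable def pVarPath {E : Type*} [NormedAddCommGroup E] (r : ℝ)
    (X : ℝ → E) : ℝ≥0∞ :=
  (⨆ (k : ℕ) (t : { t : Fin (k + 1) → ℝ // IsPartition t }),
    ENNReal.ofReal (∑ i : Fin k, ‖X (t.1 i.succ) - X (t.1 i.castSucc)‖ ^ r)) ^ (1 / r)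

/-- The Besov (Sobolev–Slobodeckij) seminorm
`‖X‖_{W^{β,q}} = (∫_0^1 ∫_0^1 ‖X(t) − X(s)‖^q |t − s|^{−1−βq} ds dt)^{1/q}`,
valued in `[0,∞]`. -/
noncomputable def besovSeminorm {E : Type*} [NormedAddCommGroup E]
    (β q : ℝ) (X : ℝ → E) : ℝ≥0∞ :=
  (∫⁻ s in Icc (0 : ℝ) 1, ∫⁻ t in Icc (0 : ℝ) 1,
    ENNReal.ofReal (‖X t - X s‖ ^ q * |t - s| ^ (-1 - β * q))) ^ (1 / q)

theorem bve_jensen (q : ℝ) (hq : 1 ≤ q) (μ ν : Measure ℝ) [IsProbabilityMeasure μ]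
    [IsProbabilityMeasure ν] (f : ℝ × ℝ → ℝ) (hf : Continuous f) :
    ∫⁻ u, ∫⁻ v, ‖f (u, v)‖ₑ ∂ν ∂μ ≤ (∫⁻ u, ∫⁻ v, ‖f (u, v)‖ₑ ^ q ∂ν ∂μ) ^ (1 / q) := by
  have h := eLpNorm'_le_eLpNorm'_mul_rpow_measure_univ (μ := μ.prod ν) (f := f)
    (p := 1) (q := q) one_pos hq hf.aestronglyMeasurable
  have h1 : Measurable fun z : ℝ × ℝ => ‖f z‖ₑ := by fun_prop
  have h2 : Measurable fun z : ℝ × ℝ => ‖f z‖ₑ ^ q := by fun_prop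
  simp only [eLpNorm', ENNReal.rpow_one, one_div, inv_one, measure_univ, ENNReal.one_rpow,
    mul_one] at h
  rw [lintegral_prod _ h1.aemeasurable, lintegral_prod _ h2.aemeasurable] at h
  simpa using h

theorem bve_pointwise (q β a d ℓ : ℝ) (hq : 1 ≤ q) (hβ : 0 < β) (ha : 0 ≤ a) (hd : 0 ≤ d)
    (hdℓ : d ≤ ℓ) (h0 : d = 0 → a = 0) :
    a ^ q ≤ ℓ ^ (1 + β * q) * (a ^ q * d ^ (-1 - β * q)) := by
  rcases hd.eq_or_lt with h | h
  · have := h0 h.symm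
    subst this
    rw [Real.zero_rpow (by linarith)]
    simp
  · have h1 : d ^ (1 + β * q) ≤ ℓ ^ (1 + β * q) :=
      Real.rpow_le_rpow hd hdℓ (by nlinarith)
    have h2 : d ^ (1 + β * q) * d ^ (-1 - β * q) = 1 := by
      rw [← Real.rpow_add h]; ring_nf; simp
    have h3 : 0 ≤ d ^ (-1 - β * q) := Real.rpow_nonneg hd _
    have h4 : 0 ≤ a ^ q := Real.rpow_nonneg ha _
    calc a ^ q = a ^ q * (d ^ (1 + β * q) * d ^ (-1 - β * q)) := by rw [h2, mul_one]
      _ ≤ a ^ q * (ℓ ^ (1 + β * q) * d ^ (-1 - β * q)) := by gcongr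
      _ = _ := by ring

theorem bve_sum_le (H : ℝ → ℝ≥0∞) : ∀ (k : ℕ) (t : Fin (k + 1) → ℝ), Monotone t →
    ∑ i : Fin k, ∫⁻ u in Ioc (t i.castSucc) (t i.succ), H u ≤
      ∫⁻ u in Ioc (t 0) (t (Fin.last k)), H u := by
  intro k
  induction k with
  | zero => intro t _; simp
  | succ k ih =>
    intro t ht
    rw [Fin.sum_univ_castSucc]
    have h := ih (fun i => t i.castSucc) (ht.comp Fin.strictMono_castSucc.monotone)
    have e : Ioc (t 0) (t (Fin.last (k+1))) =
        Ioc (t 0) (t (Fin.last k).castSucc) ∪ Ioc (t (Fin.last k).castSucc) (t (Fin.last (k+1))) :=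
      (Ioc_union_Ioc_eq_Ioc (ht (Fin.zero_le _)) (ht (Fin.le_last _))).symm
    rw [e, lintegral_union measurableSet_Ioc
      (Set.disjoint_left.2 fun x hx hy => absurd hx.2 (not_le.2 hy.1))]
    exact add_le_add h le_rfl

/-- The Besov kernel. -/
noncomputable def bveG {E : Type} [NormedAddCommGroup E] (β q : ℝ) (Y : ℝ → E) (u v : ℝ) : ℝ≥0∞ :=
  ENNReal.ofReal (‖Y v - Y u‖ ^ q * |v - u| ^ (-1 - β * q))

theorem bve_step {E : Type} [NormedAddCommGroup E] (q β : ℝ) (hq : 1 ≤ q) (hβ : 0 < β)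
    (Y : ℝ → E) (hY : Continuous Y) (t ℓ : ℝ) (hℓ : 0 < ℓ) (J J' A : Set ℝ)
    (hJm : MeasurableSet J) (hJm' : MeasurableSet J') (hJA : J ⊆ A)
    (hJJ : J' ⊆ J) (hv : volume J = ENNReal.ofReal ℓ) (hv' : volume J' = ENNReal.ofReal (ℓ / 2))
    (hd : ∀ u ∈ J, ∀ v ∈ J, |v - u| ≤ ℓ) :
    ∫⁻ u, ‖Y u - Y t‖ₑ ∂((volume J)⁻¹ • volume.restrict J) ≤
      ∫⁻ u, ‖Y u - Y t‖ₑ ∂((volume J')⁻¹ • volume.restrict J') +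
      ENNReal.ofReal (2 ^ (1 / q) * ℓ ^ (β - 1 / q)) *
        (∫⁻ u in A, ∫⁻ v in A, bveG β q Y u v) ^ (1 / q) := by
  have hq0 : 0 < q := by linarith
  have hP : IsProbabilityMeasure ((volume J)⁻¹ • volume.restrict J) := by
    constructor
    simp only [Measure.smul_apply, Measure.restrict_apply_univ, smul_eq_mul]
    rw [hv]
    exact ENNReal.inv_mul_cancel (by simpa using hℓ) (by simp)
  have hP' : IsProbabilityMeasure ((volume J')⁻¹ • volume.restrict J') := by
    constructor
    simp only [Measure.smul_apply, Measure.restrict_apply_univ, smul_eq_mul]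
    rw [hv']
    exact ENNReal.inv_mul_cancel (by simpa using hℓ) (by simp)
  have key : ∫⁻ u, ∫⁻ v, ‖Y v - Y u‖ₑ ^ q ∂((volume J')⁻¹ • volume.restrict J')
      ∂((volume J)⁻¹ • volume.restrict J) ≤
      ENNReal.ofReal (2 * ℓ ^ (β * q - 1)) * ∫⁻ u in A, ∫⁻ v in A, bveG β q Y u v := by
    simp only [lintegral_smul_measure, smul_eq_mul]
    rw [lintegral_const_mul' _ _ (by rw [hv']; simpa using hℓ)]
    have h1 : ∫⁻ u in J, ∫⁻ v in J', ‖Y v - Y u‖ₑ ^ q ≤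
        ENNReal.ofReal (ℓ ^ (1 + β * q)) * ∫⁻ u in A, ∫⁻ v in A, bveG β q Y u v := by
      calc ∫⁻ u in J, ∫⁻ v in J', ‖Y v - Y u‖ₑ ^ q
          ≤ ∫⁻ u in J, ∫⁻ v in J', ENNReal.ofReal (ℓ ^ (1 + β * q)) * bveG β q Y u v := by
            refine setLIntegral_mono' hJm fun u hu => setLIntegral_mono' hJm' fun v hv => ?_
            rw [bveG, ← ENNReal.ofReal_mul (by positivity), ← ofReal_norm,
              ENNReal.ofReal_rpow_of_nonneg (norm_nonneg _) hq0.le]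
            apply ENNReal.ofReal_le_ofReal
            apply bve_pointwise q β _ _ ℓ hq hβ (norm_nonneg _) (abs_nonneg _)
              (hd u hu v (hJJ hv))
            intro h
            have : v = u := by linarith [abs_eq_zero.1 h]
            simp [this]
        _ = ENNReal.ofReal (ℓ ^ (1 + β * q)) * ∫⁻ u in J, ∫⁻ v in J', bveG β q Y u v := by
            simp only [lintegral_const_mul' _ _ ENNReal.ofReal_ne_top]
        _ ≤ _ := by
            refine mul_le_mul_right ?_ _
            refine (lintegral_mono_set hJA).trans (lintegral_mono fun u => ?_)
            exact lintegral_mono_set (hJJ.trans hJA)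
    calc _ ≤ (volume J)⁻¹ * ((volume J')⁻¹ * (ENNReal.ofReal (ℓ ^ (1 + β * q)) *
          ∫⁻ u in A, ∫⁻ v in A, bveG β q Y u v)) := by gcongr
      _ = _ := by
        rw [hv, hv', ← ENNReal.ofReal_inv_of_pos hℓ, ← ENNReal.ofReal_inv_of_pos (half_pos hℓ),
          ← mul_assoc, ← mul_assoc, ← ENNReal.ofReal_mul (by positivity),
          ← ENNReal.ofReal_mul (by positivity)]
        congr 2
        have : ℓ ^ (1 + β * q) = ℓ ^ (β * q - 1) * ℓ ^ 2 := by
          rw [← Real.rpow_natCast, ← Real.rpow_add hℓ]; congr 1; push_cast; ring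
        rw [this]; field_simp
  have jen := bve_jensen q hq ((volume J)⁻¹ • volume.restrict J)
    ((volume J')⁻¹ • volume.restrict J') (fun z => ‖Y z.2 - Y z.1‖) (by fun_prop)
  simp only [enorm_norm] at jen
  have fin : (∫⁻ u, ∫⁻ v, ‖Y v - Y u‖ₑ ^ q ∂((volume J')⁻¹ • volume.restrict J')
      ∂((volume J)⁻¹ • volume.restrict J)) ^ (1 / q) ≤
      ENNReal.ofReal (2 ^ (1 / q) * ℓ ^ (β - 1 / q)) *
        (∫⁻ u in A, ∫⁻ v in A, bveG β q Y u v) ^ (1 / q) := by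
    refine (ENNReal.rpow_le_rpow key (by positivity)).trans (le_of_eq ?_)
    rw [ENNReal.mul_rpow_of_nonneg _ _ (by positivity),
      ENNReal.ofReal_rpow_of_nonneg (by positivity) (by positivity),
      Real.mul_rpow (by norm_num) (by positivity), ← Real.rpow_mul hℓ.le]
    congr 5
    field_simp
  generalize (volume J)⁻¹ • volume.restrict J = μ at *
  generalize (volume J')⁻¹ • volume.restrict J' = ν at *
  calc ∫⁻ u, ‖Y u - Y t‖ₑ ∂μ = ∫⁻ u, ∫⁻ v, ‖Y u - Y t‖ₑ ∂ν ∂μ := by simp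
    _ ≤ ∫⁻ u, ∫⁻ v, (‖Y v - Y t‖ₑ + ‖Y v - Y u‖ₑ) ∂ν ∂μ := by
      refine lintegral_mono fun u => lintegral_mono fun v => ?_
      have : Y u - Y t = (Y v - Y t) - (Y v - Y u) := by abel
      dsimp only
      rw [this]
      exact enorm_sub_le
    _ = ∫⁻ u, ((∫⁻ v, ‖Y v - Y t‖ₑ ∂ν) + ∫⁻ v, ‖Y v - Y u‖ₑ ∂ν) ∂μ := by
      refine lintegral_congr fun u => ?_
      exact lintegral_add_left (Continuous.measurable (by fun_prop)) _
    _ = (∫⁻ v, ‖Y v - Y t‖ₑ ∂ν) + ∫⁻ u, ∫⁻ v, ‖Y v - Y u‖ₑ ∂ν ∂μ := by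
      rw [lintegral_add_left measurable_const]; simp
    _ ≤ _ := by
      gcongr
      exact jen.trans fin

/-- The constant of the one-sided estimate. -/
noncomputable def bveK (β q : ℝ) : ℝ := 2 ^ (1 / q) * (1 - (2 : ℝ) ^ (-(β - 1 / q)))⁻¹

theorem bve_endpoint {E : Type} [NormedAddCommGroup E] (q β : ℝ) (hq : 1 ≤ q) (hβ : 1 / q < β)
    (Y : ℝ → E) (hY : Continuous Y) (t L : ℝ) (hL : 0 < L) (J : ℕ → Set ℝ)
    (hJm : ∀ n, MeasurableSet (J n))
    (hJJ : ∀ n, J (n + 1) ⊆ J n) (hv : ∀ n, volume (J n) = ENNReal.ofReal (L / 2 ^ n))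
    (ht : ∀ n, ∀ u ∈ J n, |u - t| ≤ L / 2 ^ n)
    (hd : ∀ n, ∀ u ∈ J n, ∀ v ∈ J n, |v - u| ≤ L / 2 ^ n) :
    ∫⁻ u, ‖Y u - Y t‖ₑ ∂((volume (J 0))⁻¹ • volume.restrict (J 0)) ≤
      ENNReal.ofReal (bveK β q * L ^ (β - 1 / q)) *
        (∫⁻ u in J 0, ∫⁻ v in J 0, bveG β q Y u v) ^ (1 / q) := by
  have hq0 : 0 < q := by linarith
  have hβ0 : 0 < β := lt_trans (by positivity) hβ
  have hanti : Antitone J := antitone_nat_of_succ_le hJJ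
  set B := (∫⁻ u in J 0, ∫⁻ v in J 0, bveG β q Y u v) ^ (1 / q) with hB
  set γ := β - 1 / q with hγ
  have hγ0 : 0 < γ := by linarith
  set r : ℝ := 2 ^ (-γ) with hr
  have hr0 : 0 < r := by positivity
  have hr1 : r < 1 := Real.rpow_lt_one_of_one_lt_of_neg (by norm_num) (by linarith)
  set D : ℕ → ℝ≥0∞ := fun n => ∫⁻ u, ‖Y u - Y t‖ₑ ∂((volume (J n))⁻¹ • volume.restrict (J n))
    with hD
  have step : ∀ n, D n ≤ D (n + 1) + ENNReal.ofReal (2 ^ (1 / q) * L ^ γ * r ^ n) * B := by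
    intro n
    have h := bve_step q β hq hβ0 Y hY t (L / 2 ^ n) (by positivity) (J n) (J (n + 1)) (J 0)
      (hJm n) (hJm _) (hanti (Nat.zero_le n)) (hJJ n) (hv n)
      (by rw [hv, pow_succ]; congr 1; field_simp) (hd n)
    have e : (L / 2 ^ n) ^ γ = L ^ γ * r ^ n := by
      rw [Real.div_rpow hL.le (by positivity), hr, Real.rpow_neg (by norm_num), inv_pow,
        ← Real.rpow_natCast, ← Real.rpow_natCast, ← Real.rpow_mul (by norm_num),
        ← Real.rpow_mul (by norm_num), mul_comm γ]
      rfl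
    rw [← hγ, e, ← mul_assoc] at h
    exact h
  have iter : ∀ n, D 0 ≤ D n +
      ENNReal.ofReal (2 ^ (1 / q) * L ^ γ * ∑ k ∈ Finset.range n, r ^ k) * B := by
    intro n
    induction n with
    | zero => simp
    | succ n ih =>
      refine ih.trans ?_
      rw [Finset.sum_range_succ, mul_add, ENNReal.ofReal_add (by positivity) (by positivity),
        add_mul, add_comm (ENNReal.ofReal _ * B), ← add_assoc]
      gcongr
      exact step n
  have iter2 : ∀ n, D 0 ≤ D n + ENNReal.ofReal (bveK β q * L ^ γ) * B := by
    intro n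
    refine (iter n).trans ?_
    refine add_le_add le_rfl (mul_le_mul_left (ENNReal.ofReal_le_ofReal ?_) _)
    have : ∑ k ∈ Finset.range n, r ^ k ≤ (1 - r)⁻¹ := by
      rw [← tsum_geometric_of_lt_one hr0.le hr1]
      exact (summable_geometric_of_lt_one hr0.le hr1).sum_le_tsum _ (fun i _ => by positivity)
    rw [bveK, ← hγ, ← hr, mul_assoc, mul_assoc, mul_comm (L ^ γ)]
    gcongr
  refine ENNReal.le_of_forall_pos_le_add fun ε hε _ => ?_
  obtain ⟨δ, hδ, hδε⟩ := Metric.continuous_iff.1 hY t ε (by exact_mod_cast hε)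
  obtain ⟨n, hn⟩ : ∃ n : ℕ, L / 2 ^ n < δ := by
    have h := (tendsto_pow_atTop_nhds_zero_of_lt_one (r := (1 / 2 : ℝ)) (by norm_num)
      (by norm_num)).const_mul L
    rw [mul_zero] at h
    obtain ⟨n, hn⟩ := (h.eventually (gt_mem_nhds hδ)).exists
    exact ⟨n, by simpa [div_eq_mul_inv] using hn⟩
  have hDn : D n ≤ ε := by
    simp only [hD, lintegral_smul_measure, smul_eq_mul]
    have : ∫⁻ u in J n, ‖Y u - Y t‖ₑ ≤ ∫⁻ u in J n, (ε : ℝ≥0∞) := by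
      refine setLIntegral_mono' (hJm n) fun u hu => ?_
      have := hδε u (by rw [Real.dist_eq]; exact (ht n u hu).trans_lt hn)
      rw [dist_eq_norm] at this
      rw [← ofReal_norm, ← ENNReal.ofReal_coe_nnreal]
      exact ENNReal.ofReal_le_ofReal this.le
    rw [setLIntegral_const] at this
    calc _ ≤ (volume (J n))⁻¹ * (ε * volume (J n)) := by gcongr
      _ = ε * ((volume (J n))⁻¹ * volume (J n)) := by ring
      _ = ε := by
        rw [ENNReal.inv_mul_cancel, mul_one]
        · rw [hv]; simp only [ne_eq, ENNReal.ofReal_eq_zero, not_le]; positivity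
        · rw [hv]; simp
  rw [add_comm]
  refine (iter2 n).trans ?_
  gcongr

theorem bve_local {E : Type} [NormedAddCommGroup E] (q β : ℝ) (hq : 1 ≤ q) (hβ : 1 / q < β)
    (Y : ℝ → E) (hY : Continuous Y) (s t : ℝ) (hst : s ≤ t) :
    ‖Y t - Y s‖ₑ ≤ ENNReal.ofReal (2 * bveK β q) * (ENNReal.ofReal (t - s) ^ (β - 1 / q) *
        (∫⁻ u in Ioc s t, ∫⁻ v in Ioc s t, bveG β q Y u v) ^ (1 / q)) := by
  rcases hst.eq_or_lt with rfl | hlt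
  · simp
  have hL : 0 < t - s := by linarith
  have hpow : ∀ n : ℕ, (t - s) / 2 ^ (n + 1) ≤ (t - s) / 2 ^ n := by
    intro n
    rw [pow_succ]
    apply div_le_div_of_nonneg_left hL.le (by positivity)
    linarith [show (0:ℝ) < 2 ^ n by positivity]
  have h1 := bve_endpoint q β hq hβ Y hY t (t - s) hL (fun n => Ioc (t - (t - s) / 2 ^ n) t)
    (fun n => measurableSet_Ioc) (fun n => Ioc_subset_Ioc_left (by linarith [hpow n]))
    (fun n => by simp)
    (fun n u hu => by rw [abs_le]; constructor <;> linarith [hu.1, hu.2])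
    (fun n u hu v hv => by rw [abs_le]; constructor <;> linarith [hu.1, hu.2, hv.1, hv.2])
  have h2 := bve_endpoint q β hq hβ Y hY s (t - s) hL (fun n => Ioc s (s + (t - s) / 2 ^ n))
    (fun n => measurableSet_Ioc) (fun n => Ioc_subset_Ioc_right (by linarith [hpow n]))
    (fun n => by simp)
    (fun n u hu => by rw [abs_le]; constructor <;> linarith [hu.1, hu.2])
    (fun n u hu v hv => by rw [abs_le]; constructor <;> linarith [hu.1, hu.2, hv.1, hv.2])
  simp only [pow_zero, div_one, sub_sub_cancel, add_sub_cancel] at h1 h2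
  have hP : IsProbabilityMeasure ((volume (Ioc s t))⁻¹ • volume.restrict (Ioc s t)) := by
    constructor
    simp only [Measure.smul_apply, Measure.restrict_apply_univ, smul_eq_mul]
    rw [Real.volume_Ioc]
    exact ENNReal.inv_mul_cancel (by simpa using hlt) (by simp)
  have hγ0 : 0 < β - 1 / q := by linarith
  have hK : 0 ≤ bveK β q := by
    have : (2 : ℝ) ^ (-(β - 1 / q)) < 1 :=
      Real.rpow_lt_one_of_one_lt_of_neg (by norm_num) (by linarith)
    have : 0 ≤ (1 - (2 : ℝ) ^ (-(β - 1 / q)))⁻¹ := inv_nonneg.2 (by linarith)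
    unfold bveK
    positivity
  generalize (volume (Ioc s t))⁻¹ • volume.restrict (Ioc s t) = μ at *
  calc ‖Y t - Y s‖ₑ = ∫⁻ u, ‖Y t - Y s‖ₑ ∂μ := by simp
    _ ≤ ∫⁻ u, (‖Y u - Y s‖ₑ + ‖Y u - Y t‖ₑ) ∂μ := by
      refine lintegral_mono fun u => ?_
      have : Y t - Y s = (Y u - Y s) - (Y u - Y t) := by abel
      dsimp only
      rw [this]
      exact enorm_sub_le
    _ = ∫⁻ u, ‖Y u - Y s‖ₑ ∂μ + ∫⁻ u, ‖Y u - Y t‖ₑ ∂μ :=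
      lintegral_add_left (Continuous.measurable (by fun_prop)) _
    _ ≤ _ := by
      refine (add_le_add h2 h1).trans (le_of_eq ?_)
      rw [← two_mul, ENNReal.ofReal_mul hK, ENNReal.ofReal_mul (by norm_num),
        ENNReal.ofReal_rpow_of_nonneg hL.le hγ0.le]
      simp only [ENNReal.ofReal_ofNat]
      ring

theorem bve_global {E : Type} [NormedAddCommGroup E] (q β : ℝ) (hq : 1 ≤ q) (hβ : 1 / q < β)
    (Y : ℝ → E) (hY : Continuous Y) (k : ℕ) (t : Fin (k + 1) → ℝ) (ht : IsPartition t) :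
    ∑ i : Fin k, ‖Y (t i.succ) - Y (t i.castSucc)‖ₑ ^ (1 / β) ≤
      (ENNReal.ofReal (2 * bveK β q)) ^ (1 / β) *
        (∫⁻ u in Ioc 0 1, ∫⁻ v in Ioc 0 1, bveG β q Y u v) ^ (1 / (β * q)) := by
  obtain ⟨hm, h0, h1⟩ := ht
  have hq0 : 0 < q := by linarith
  have hβ0 : 0 < β := lt_trans (by positivity) hβ
  have hbq : 1 < β * q := by rwa [div_lt_iff₀ hq0] at hβ
  have hθ1 : 1 / (β * q) < 1 := by rw [div_lt_one (by linarith)]; exact hbq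
  have hθ0 : 0 < 1 / (β * q) := by positivity
  set θ := 1 / (β * q) with hθ
  set B : Fin k → ℝ≥0∞ := fun i => ∫⁻ u in Ioc (t i.castSucc) (t i.succ),
    ∫⁻ v in Ioc (t i.castSucc) (t i.succ), bveG β q Y u v with hB
  have hle : ∀ i : Fin k, t i.castSucc ≤ t i.succ := fun i => hm i.castSucc_lt_succ.le
  have hsub : ∀ i : Fin k, Ioc (t i.castSucc) (t i.succ) ⊆ Ioc (0:ℝ) 1 := fun i =>
    Ioc_subset_Ioc (h0 ▸ hm (Fin.zero_le _)) (h1 ▸ hm (Fin.le_last _))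
  have hBsum : ∑ i, B i ≤ ∫⁻ u in Ioc 0 1, ∫⁻ v in Ioc 0 1, bveG β q Y u v := by
    have := bve_sum_le (fun u => ∫⁻ v in Ioc 0 1, bveG β q Y u v) k t hm
    rw [h0, h1] at this
    refine le_trans (Finset.sum_le_sum fun i _ => ?_) this
    exact lintegral_mono fun u => lintegral_mono_set (hsub i)
  have hLsum : ∑ i : Fin k, ENNReal.ofReal (t i.succ - t i.castSucc) ≤ 1 := by
    have := bve_sum_le (fun _ => 1) k t hm
    rw [h0, h1] at this
    simpa using this
  have hHC : Real.HolderConjugate (1 / (1 - θ)) (1 / θ) := by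
    rw [Real.holderConjugate_iff]
    constructor
    · rw [lt_div_iff₀ (by linarith)]; linarith
    · simp
  have hold := ENNReal.inner_le_Lp_mul_Lq Finset.univ
    (fun i : Fin k => ENNReal.ofReal (t i.succ - t i.castSucc) ^ (1 - θ)) (fun i => B i ^ θ) hHC
  have e1 : (1 - θ) * (1 / (1 - θ)) = 1 := mul_one_div_cancel (by linarith)
  have e2 : θ * (1 / θ) = 1 := mul_one_div_cancel (by linarith)
  simp only [← ENNReal.rpow_mul, e1, e2, ENNReal.rpow_one, one_div_one_div] at hold
  calc ∑ i : Fin k, ‖Y (t i.succ) - Y (t i.castSucc)‖ₑ ^ (1 / β)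
      ≤ ∑ i : Fin k, (ENNReal.ofReal (2 * bveK β q)) ^ (1 / β) *
        (ENNReal.ofReal (t i.succ - t i.castSucc) ^ (1 - θ) * B i ^ θ) := by
        refine Finset.sum_le_sum fun i _ => ?_
        refine (ENNReal.rpow_le_rpow (bve_local q β hq hβ Y hY _ _ (hle i))
          (by positivity)).trans (le_of_eq ?_)
        rw [ENNReal.mul_rpow_of_nonneg _ _ (by positivity),
          ENNReal.mul_rpow_of_nonneg _ _ (by positivity), ← ENNReal.rpow_mul, ← ENNReal.rpow_mul]
        have a1 : (β - 1 / q) * (1 / β) = 1 - θ := by rw [hθ]; field_simp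
        have a2 : 1 / q * (1 / β) = θ := by rw [hθ]; field_simp
        rw [a1, a2]
    _ = (ENNReal.ofReal (2 * bveK β q)) ^ (1 / β) *
        ∑ i : Fin k, (ENNReal.ofReal (t i.succ - t i.castSucc) ^ (1 - θ) * B i ^ θ) := by
        rw [Finset.mul_sum]
    _ ≤ _ := by
        gcongr
        refine hold.trans ?_
        calc _ ≤ (1 : ℝ≥0∞) ^ (1 - θ) *
              (∫⁻ u in Ioc 0 1, ∫⁻ v in Ioc 0 1, bveG β q Y u v) ^ θ := by
              gcongr
          _ = _ := by simp

/-- **Besov–variation embedding.** For `q ∈ [1,∞)` and `β ∈ (1/q, 1)` there is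
a constant `C = C(β, q)` such that every continuous path `X : [0,1] → E` (into
a Banach space) with finite Besov seminorm `M` satisfies
`‖X‖_{(1/β)-var} ≤ C M`. -/
theorem besov_variation_embedding (q β : ℝ) (hq : 1 ≤ q) (hβl : 1 / q < β)
    (hβu : β < 1) :
    ∃ C : ℝ, 0 < C ∧
      ∀ (E : Type) [NormedAddCommGroup E] [NormedSpace ℝ E] [CompleteSpace E],
        ∀ X : ℝ → E, ContinuousOn X (Icc 0 1) →
          besovSeminorm β q X < ⊤ →
          pVarPath (1 / β) X ≤ ENNReal.ofReal C * besovSeminorm β q X := by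
  have hq0 : 0 < q := by linarith
  have hβ0 : 0 < β := lt_trans (by positivity) hβl
  refine ⟨2 * bveK β q, ?_, ?_⟩
  · have : (2 : ℝ) ^ (-(β - 1 / q)) < 1 :=
      Real.rpow_lt_one_of_one_lt_of_neg (by norm_num) (by linarith)
    have : 0 < (1 - (2 : ℝ) ^ (-(β - 1 / q)))⁻¹ := inv_pos.2 (by linarith)
    unfold bveK
    positivity
  intro E _ _ _ X hX _
  set Y : ℝ → E := IccExtend (zero_le_one' ℝ) ((Icc (0:ℝ) 1).domRestrict X) with hYdef
  have hY : Continuous Y := (continuousOn_iff_continuous_domRestrict.1 hX).Icc_extend'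
  have hXY : ∀ u ∈ Icc (0:ℝ) 1, Y u = X u := fun u hu => by
    rw [hYdef, IccExtend_of_mem _ _ hu]; rfl
  have hbes : besovSeminorm β q X =
      (∫⁻ u in Ioc 0 1, ∫⁻ v in Ioc 0 1, bveG β q Y u v) ^ (1 / q) := by
    unfold besovSeminorm
    congr 1
    simp only [restrict_Ioc_eq_restrict_Icc]
    refine setLIntegral_congr_fun measurableSet_Icc fun u hu => ?_
    refine setLIntegral_congr_fun measurableSet_Icc fun v hv => ?_
    simp only [bveG, hXY u hu, hXY v hv]
  rw [hbes, pVarPath, one_div_one_div]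
  have hsup : (⨆ (k : ℕ) (t : { t : Fin (k + 1) → ℝ // IsPartition t }),
      ENNReal.ofReal (∑ i : Fin k, ‖X (t.1 i.succ) - X (t.1 i.castSucc)‖ ^ (1 / β))) ≤
      (ENNReal.ofReal (2 * bveK β q)) ^ (1 / β) *
        (∫⁻ u in Ioc 0 1, ∫⁻ v in Ioc 0 1, bveG β q Y u v) ^ (1 / (β * q)) := by
    refine iSup_le fun k => iSup_le fun t => ?_
    refine le_trans (le_of_eq ?_) (bve_global q β hq hβl Y hY k t.1 t.2)
    obtain ⟨t, hm, h0, h1⟩ := t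
    have hmem : ∀ i, t i ∈ Icc (0:ℝ) 1 := fun i =>
      ⟨h0 ▸ hm (Fin.zero_le _), h1 ▸ hm (Fin.le_last _)⟩
    rw [ENNReal.ofReal_sum_of_nonneg (fun i _ => by positivity)]
    refine Finset.sum_congr rfl fun i _ => ?_
    simp only [hXY _ (hmem _)]
    rw [← ofReal_norm, ENNReal.ofReal_rpow_of_nonneg (norm_nonneg _) (by positivity)]
  refine (ENNReal.rpow_le_rpow hsup hβ0.le).trans (le_of_eq ?_)
  rw [ENNReal.mul_rpow_of_nonneg _ _ hβ0.le, ← ENNReal.rpow_mul, ← ENNReal.rpow_mul]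
  have a1 : 1 / β * β = 1 := by field_simp
  have a2 : 1 / (β * q) * β = 1 / q := by field_simp
  rw [a1, a2, ENNReal.rpow_one]
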